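/- arXiv:1912.02308 — 5 statements merged into one kernel-verified Lean document; each statement's English description precedes it below -/
import Mathlib

section
/- Every walk in the transfer-expanded graph Ḡ from (o,1) to (d,K+1), when projected to its sequence of underlying arcs of G, yields a walk in G from o to d that has the same number of arcs and the same cost, has at most K arcs, and in which the vertices o and d occur only as the first and the last vertex of the walk, respectively. -/
/-!
A directed multigraph `G` is given by finite types `V` (vertices) and `A` (arcs),
tail/head maps `tl hd : A → V` with `tl a ≠ hd a`, and arc costs `γ : A → ℝ`.
A walk from `u` to `v` is a nonempty list of arcs whose first arc starts at `u`,
whose last arc ends at `v`, and in which consecutive arcs match up.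
-/

namespace Stmt0

variable {V A : Type}

/-- `L` is a walk from `u` to `v` in the graph with tails `tl` and heads `hd`. -/
def IsWalk (tl hd : A → V) (u v : V) (L : List A) : Prop :=
  L ≠ [] ∧ (∀ a ∈ L.head?, tl a = u) ∧ (∀ a ∈ L.getLast?, hd a = v) ∧
    List.Chain' (fun a b => hd a = tl b) L

/-- Tail of an arc `(a, k, l)` of the transfer-expanded graph: vertex `(tl a, k)`. -/
def ExpTl (tl : A → V) (e : A × ℕ × ℕ) : V × ℕ := (tl e.1, e.2.1)

/-- Head of an arc `(a, k, l)` of the transfer-expanded graph: vertex `(hd a, l)`. -/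
def ExpHd (hd : A → V) (e : A × ℕ × ℕ) : V × ℕ := (hd e.1, e.2.2)

/-- `(a, k, l)` is an arc of the transfer-expanded graph `Ḡ` for origin `o`,
destination `d` and transfer budget `K`:
(1) arcs out of the origin go from layer 1 to layer 2 (or to layer `K+1` if they
    enter the destination directly);
(2) arcs not adjacent to the origin or the destination go from layer `k` to `k+1`
    for `2 ≤ k ≤ K-1`;
(3) arcs into the destination (not out of the origin) go from layer `k`,
    `2 ≤ k ≤ K`, to layer `K+1`. -/
def ExpValid (tl hd : A → V) (o d : V) (K : ℕ) (e : A × ℕ × ℕ) : Prop :=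
  (tl e.1 = o ∧ hd e.1 ≠ d ∧ e.2.1 = 1 ∧ e.2.2 = 2) ∨
  (tl e.1 = o ∧ hd e.1 = d ∧ e.2.1 = 1 ∧ e.2.2 = K + 1) ∨
  (tl e.1 ≠ o ∧ tl e.1 ≠ d ∧ hd e.1 ≠ o ∧ hd e.1 ≠ d ∧
    2 ≤ e.2.1 ∧ e.2.1 + 1 ≤ K ∧ e.2.2 = e.2.1 + 1) ∨
  (hd e.1 = d ∧ tl e.1 ≠ o ∧ 2 ≤ e.2.1 ∧ e.2.1 ≤ K ∧ e.2.2 = K + 1)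

/-- In the walk `L` (with visited vertices `tl a₁, …, tl aₘ, hd aₘ`), the vertex `o`
occurs only as the first visited vertex and `d` only as the last visited vertex. -/
def OnlyEnds (tl hd : A → V) (o d : V) (L : List A) : Prop :=
  (∀ a ∈ L.tail, tl a ≠ o) ∧ (∀ a ∈ L, hd a ≠ o) ∧
  (∀ a ∈ L, tl a ≠ d) ∧ (∀ a ∈ L.dropLast, hd a ≠ d)

/-- A walk in the transfer-expanded graph that starts at layer `k` outside of the origin and ends
at the destination has at most `K + 1 - k` arcs, never visits the origin, and visits the
destination only at its end. -/
theorem length_and_avoidance_of_tail_ne_origin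
    {tl hd : A → V} (hsimple : ∀ a : A, tl a ≠ hd a) {K : ℕ} {o d : V} (hod : o ≠ d)
    (L : List (A × ℕ × ℕ)) (e : A × ℕ × ℕ)
    (hvalid : ∀ x ∈ e :: L, ExpValid tl hd o d K x)
    (hchain : List.IsChain (fun a b => ExpHd hd a = ExpTl tl b) (e :: L))
    (he : tl e.1 ≠ o) :
    (e :: L).length + e.2.1 ≤ K + 1 ∧ (∀ x ∈ e :: L, tl x.1 ≠ o) ∧
      (∀ x ∈ e :: L, hd x.1 ≠ o) ∧ (∀ x ∈ e :: L, tl x.1 ≠ d) ∧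
      (∀ x ∈ (e :: L).dropLast, hd x.1 ≠ d) := by
  induction L generalizing e with
  | nil =>
    have hv := hvalid e (by simp)
    have hs := hsimple e.1
    simp only [List.length_singleton, List.mem_singleton, forall_eq, List.dropLast_singleton]
    unfold ExpValid at hv
    grind
  | cons f L ih =>
    have hv := hvalid e (by simp)
    have hw := hvalid f (by simp)
    have hs := hsimple f.1
    rw [List.isChain_cons_cons] at hchain
    obtain ⟨hef, hchain⟩ := hchain
    simp only [ExpHd, ExpTl, Prod.mk.injEq] at hef
    unfold ExpValid at hv hw
    have hf : tl f.1 ≠ o := by grind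
    obtain ⟨h1, h2, h3, h4, h5⟩ := ih f (fun x hx => hvalid x (by simp_all)) hchain hf
    rw [List.dropLast_cons_cons]
    simp only [List.forall_mem_cons (a := e), List.length_cons] at *
    grind

/-- Every walk in the transfer-expanded graph `Ḡ` from `(o,1)` to
`(d,K+1)`, projected to its sequence of underlying arcs of `G`, yields a walk in `G`
from `o` to `d` with the same number of arcs and the same cost, with at most `K`
arcs, and in which `o` and `d` occur only as the first and last vertex. -/
theorem projection_of_expanded_walk
    [Fintype V] [Fintype A]
    (tl hd : A → V) (γ : A → ℝ) (hsimple : ∀ a : A, tl a ≠ hd a)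
    (K : ℕ) (hK : 2 ≤ K) (o d : V) (hod : o ≠ d)
    (L : List (A × ℕ × ℕ))
    (hvalid : ∀ e ∈ L, ExpValid tl hd o d K e)
    (hwalk : IsWalk (ExpTl tl) (ExpHd hd) (o, 1) (d, K + 1) L) :
    IsWalk tl hd o d (L.map Prod.fst) ∧
    (L.map Prod.fst).length = L.length ∧
    ((L.map Prod.fst).map γ).sum = (L.map (fun e => γ e.1)).sum ∧
    (L.map Prod.fst).length ≤ K ∧
    OnlyEnds tl hd o d (L.map Prod.fst) := by
  obtain ⟨hne, hhead, hlast, hchain⟩ := hwalk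
  refine ⟨⟨by simpa using hne, ?_, ?_, ?_⟩, by simp, by simp [Function.comp_def], ?_⟩
  · simp only [List.head?_map, Option.mem_def, Option.map_eq_some_iff]
    rintro _ ⟨e, he, rfl⟩
    exact congrArg Prod.fst (hhead e he)
  · simp only [List.getLast?_map, Option.mem_def, Option.map_eq_some_iff]
    rintro _ ⟨e, he, rfl⟩
    exact congrArg Prod.fst (hlast e he)
  · refine (List.isChain_map _).2 (List.IsChain.imp ?_ hchain)
    exact fun a b h => congrArg Prod.fst h
  · unfold OnlyEnds
    simp only [← List.map_tail, ← List.map_dropLast, List.forall_mem_map, List.length_map]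
    cases L with
    | nil => exact absurd rfl hne
    | cons e L =>
      have hv := hvalid e (by simp)
      have hs := hsimple e.1
      have ho := hhead e (by simp)
      simp only [ExpTl, Prod.mk.injEq] at ho
      unfold ExpValid at hv
      cases L with
      | nil =>
        simp only [List.length_singleton, List.tail_cons, List.mem_singleton, forall_eq,
          List.dropLast_singleton]
        grind
      | cons f L =>
        have hchain' := List.isChain_cons_cons.1 hchain
        obtain ⟨hef, hchain⟩ := hchain'
        have hw := hvalid f (by simp)
        have hsf := hsimple f.1
        simp only [ExpHd, ExpTl, Prod.mk.injEq] at hef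
        unfold ExpValid at hw
        have hf : tl f.1 ≠ o := by grind
        obtain ⟨h1, h2, h3, h4, h5⟩ := length_and_avoidance_of_tail_ne_origin hsimple hod L f
          (fun x hx => hvalid x (List.mem_cons_of_mem e hx)) hchain hf
        rw [List.dropLast_cons_cons, List.tail_cons]
        simp only [List.forall_mem_cons (a := e), List.length_cons] at *
        grind

end Stmt0
end

section
/- Every walk in G from o to d that has at most K arcs and in which the vertices o and d occur only as the first and the last vertex of the walk, respectively, lifts to a walk in the transfer-expanded graph Ḡ from (o,1) to (d,K+1) whose sequence of underlying arcs is the given walk; in particular the lifted walk has the same number of arcs and the same cost. -/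
namespace Stmt1

variable {V A : Type}

/-- `L` is a walk from `u` to `v` in the graph with tails `tl` and heads `hd`. -/
def IsWalk (tl hd : A → V) (u v : V) (L : List A) : Prop :=
  L ≠ [] ∧ (∀ a ∈ L.head?, tl a = u) ∧ (∀ a ∈ L.getLast?, hd a = v) ∧
    List.Chain' (fun a b => hd a = tl b) L

/-- Tail of an arc `(a, k, l)` of the transfer-expanded graph: vertex `(tl a, k)`. -/
def ExpTl (tl : A → V) (e : A × ℕ × ℕ) : V × ℕ := (tl e.1, e.2.1)

/-- Head of an arc `(a, k, l)` of the transfer-expanded graph: vertex `(hd a, l)`. -/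
def ExpHd (hd : A → V) (e : A × ℕ × ℕ) : V × ℕ := (hd e.1, e.2.2)

/-- `(a, k, l)` is an arc of the transfer-expanded graph `Ḡ` for origin `o`,
destination `d` and transfer budget `K`:
(1) arcs out of the origin go from layer 1 to layer 2 (or to layer `K+1` if they
    enter the destination directly);
(2) arcs not adjacent to the origin or the destination go from layer `k` to `k+1`
    for `2 ≤ k ≤ K-1`;
(3) arcs into the destination (not out of the origin) go from layer `k`,
    `2 ≤ k ≤ K`, to layer `K+1`. -/
def ExpValid (tl hd : A → V) (o d : V) (K : ℕ) (e : A × ℕ × ℕ) : Prop :=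
  (tl e.1 = o ∧ hd e.1 ≠ d ∧ e.2.1 = 1 ∧ e.2.2 = 2) ∨
  (tl e.1 = o ∧ hd e.1 = d ∧ e.2.1 = 1 ∧ e.2.2 = K + 1) ∨
  (tl e.1 ≠ o ∧ tl e.1 ≠ d ∧ hd e.1 ≠ o ∧ hd e.1 ≠ d ∧
    2 ≤ e.2.1 ∧ e.2.1 + 1 ≤ K ∧ e.2.2 = e.2.1 + 1) ∨
  (hd e.1 = d ∧ tl e.1 ≠ o ∧ 2 ≤ e.2.1 ∧ e.2.1 ≤ K ∧ e.2.2 = K + 1)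

/-- In the walk `L` (with visited vertices `tl a₁, …, tl aₘ, hd aₘ`), the vertex `o`
occurs only as the first visited vertex and `d` only as the last visited vertex. -/
def OnlyEnds (tl hd : A → V) (o d : V) (L : List A) : Prop :=
  (∀ a ∈ L.tail, tl a ≠ o) ∧ (∀ a ∈ L, hd a ≠ o) ∧
  (∀ a ∈ L, tl a ≠ d) ∧ (∀ a ∈ L.dropLast, hd a ≠ d)

/-- Unfolding of a walk with at least two arcs at its first arc. -/
theorem isWalk_cons_cons {W B : Type} {tl hd : B → W} {u v : W} {a b : B} {L : List B} :
    IsWalk tl hd u v (a :: b :: L) ↔ tl a = u ∧ IsWalk tl hd (hd a) v (b :: L) := by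
  simp only [IsWalk, List.Chain', List.isChain_cons_cons, List.head?_cons,
    List.getLast?_cons_cons, Option.mem_def, Option.some.injEq, forall_eq', ne_eq,
    reduceCtorEq, not_false_eq_true, true_and]
  grind

/-- A walk consisting of a single arc. -/
theorem isWalk_singleton {W B : Type} {tl hd : B → W} {u v : W} {a : B} :
    IsWalk tl hd u v [a] ↔ tl a = u ∧ hd a = v := by
  simp [IsWalk, List.Chain']

/-- Prepending an arc to a walk starting at its head. -/
theorem IsWalk.cons {W B : Type} {tl hd : B → W} {v : W} {a : B} {L : List B}
    (h : IsWalk tl hd (hd a) v L) : IsWalk tl hd (tl a) v (a :: L) := by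
  cases L with
  | nil => exact absurd rfl h.1
  | cons b L => exact isWalk_cons_cons.2 ⟨rfl, h⟩

/-- A walk to `d` that avoids `o` and reaches `d` only at its end lifts to the
transfer-expanded graph from any layer `k ≥ 2` that leaves enough layers for its arcs. -/
theorem exists_lift_from_layer {tl hd : A → V} {o d : V} {K : ℕ} {P : List A} :
    ∀ {u : V} {k : ℕ}, IsWalk tl hd u d P → 2 ≤ k → k + P.length ≤ K + 1 →
      (∀ a ∈ P, tl a ≠ o) → (∀ a ∈ P, hd a ≠ o) → (∀ a ∈ P, tl a ≠ d) →
      (∀ a ∈ P.dropLast, hd a ≠ d) →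
      ∃ L : List (A × ℕ × ℕ), (∀ e ∈ L, ExpValid tl hd o d K e) ∧
        IsWalk (ExpTl tl) (ExpHd hd) (u, k) (d, K + 1) L ∧ L.map Prod.fst = P := by
  induction P with
  | nil => exact fun h => absurd rfl h.1
  | cons a P ih =>
    intro u k hw hk hlen hto hho htd hhd
    cases P with
    | nil =>
      obtain ⟨rfl, rfl⟩ := isWalk_singleton.1 hw
      refine ⟨[(a, k, K + 1)], ?_, isWalk_singleton.2 ⟨rfl, rfl⟩, rfl⟩
      simp only [List.length_singleton] at hlen
      simp only [List.mem_singleton, forall_eq] at hto ⊢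
      exact Or.inr (Or.inr (Or.inr ⟨rfl, hto, hk, by simpa using hlen, rfl⟩))
    | cons b P =>
      obtain ⟨rfl, hw'⟩ := isWalk_cons_cons.1 hw
      rw [List.dropLast_cons_cons, List.forall_mem_cons] at hhd
      rw [List.forall_mem_cons] at hto hho htd
      simp only [List.length_cons] at hlen ih
      obtain ⟨L, hL, hLw, hLm⟩ := ih hw' (k := k + 1) (by omega) (by omega)
        hto.2 hho.2 htd.2 hhd.2
      exact ⟨(a, k, k + 1) :: L, List.forall_mem_cons.2 ⟨Or.inr (Or.inr (Or.inl
        ⟨hto.1, htd.1, hho.1, hhd.1, hk, by simp only; omega, rfl⟩)), hL⟩,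
        IsWalk.cons (a := (a, k, k + 1)) hLw, by simp [hLm]⟩

/-- Every walk in `G` from `o` to `d` with at most `K` arcs, in which
`o` and `d` occur only as the first and last vertex, lifts to a walk in the
transfer-expanded graph `Ḡ` from `(o,1)` to `(d,K+1)` whose sequence of underlying
arcs is the given walk; in particular the lift has the same length and cost. -/
theorem lift_to_expanded_walk
    [Fintype V] [Fintype A]
    (tl hd : A → V) (γ : A → ℝ) (hsimple : ∀ a : A, tl a ≠ hd a)
    (K : ℕ) (hK : 2 ≤ K) (o d : V) (hod : o ≠ d)
    (P : List A)
    (hwalk : IsWalk tl hd o d P)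
    (hlen : P.length ≤ K)
    (honly : OnlyEnds tl hd o d P) :
    ∃ L : List (A × ℕ × ℕ),
      (∀ e ∈ L, ExpValid tl hd o d K e) ∧
      IsWalk (ExpTl tl) (ExpHd hd) (o, 1) (d, K + 1) L ∧
      L.map Prod.fst = P ∧
      L.length = P.length ∧
      (L.map (fun e => γ e.1)).sum = (P.map γ).sum := by
  suffices h : ∃ L : List (A × ℕ × ℕ), (∀ e ∈ L, ExpValid tl hd o d K e) ∧
      IsWalk (ExpTl tl) (ExpHd hd) (o, 1) (d, K + 1) L ∧ L.map Prod.fst = P by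
    obtain ⟨L, hL, hLw, rfl⟩ := h
    exact ⟨L, hL, hLw, rfl, (List.length_map _).symm, by rw [List.map_map]; rfl⟩
  obtain ⟨hto, hho, htd, hhd⟩ := honly
  match P with
  | [] => exact absurd rfl hwalk.1
  | [a] =>
    obtain ⟨rfl, rfl⟩ := isWalk_singleton.1 hwalk
    refine ⟨[(a, 1, K + 1)], ?_, isWalk_singleton.2 ⟨rfl, rfl⟩, rfl⟩
    simp [ExpValid]
  | a :: b :: P =>
    obtain ⟨rfl, hw⟩ := isWalk_cons_cons.1 hwalk
    rw [List.dropLast_cons_cons, List.forall_mem_cons] at hhd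
    rw [List.forall_mem_cons] at hho htd
    obtain ⟨L, hL, hLw, hLm⟩ := exists_lift_from_layer (K := K) hw le_rfl
      (by simp only [List.length_cons] at hlen ⊢; omega) hto hho.2 htd.2 hhd.2
    exact ⟨(a, 1, 2) :: L, List.forall_mem_cons.2 ⟨Or.inl ⟨rfl, hhd.1, rfl, rfl⟩, hL⟩,
      IsWalk.cons (a := (a, 1, 2)) hLw, by simp [hLm]⟩

end Stmt1
end

section
/- The set of costs of walks in G from o to d that have at most K arcs and in which o and d occur only as the first and the last vertex, respectively, is equal to the set of costs of walks in the transfer-expanded graph Ḡ from (o,1) to (d,K+1). Consequently, the infimum of the cost over the first set of walks equals the infimum of the cost over the second set of walks; i.e., the cardinality-constrained shortest path problem on G is equivalent to the unconstrained shortest path problem on Ḡ. -/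
namespace Stmt2

variable {V A : Type}

/-- `L` is a walk from `u` to `v` in the graph with tails `tl` and heads `hd`. -/
def IsWalk (tl hd : A → V) (u v : V) (L : List A) : Prop :=
  L ≠ [] ∧ (∀ a ∈ L.head?, tl a = u) ∧ (∀ a ∈ L.getLast?, hd a = v) ∧
    List.Chain' (fun a b => hd a = tl b) L

/-- Tail of an arc `(a, k, l)` of the transfer-expanded graph: vertex `(tl a, k)`. -/
def ExpTl (tl : A → V) (e : A × ℕ × ℕ) : V × ℕ := (tl e.1, e.2.1)

/-- Head of an arc `(a, k, l)` of the transfer-expanded graph: vertex `(hd a, l)`. -/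
def ExpHd (hd : A → V) (e : A × ℕ × ℕ) : V × ℕ := (hd e.1, e.2.2)

/-- `(a, k, l)` is an arc of the transfer-expanded graph `Ḡ` for origin `o`,
destination `d` and transfer budget `K`:
(1) arcs out of the origin go from layer 1 to layer 2 (or to layer `K+1` if they
    enter the destination directly);
(2) arcs not adjacent to the origin or the destination go from layer `k` to `k+1`
    for `2 ≤ k ≤ K-1`;
(3) arcs into the destination (not out of the origin) go from layer `k`,
    `2 ≤ k ≤ K`, to layer `K+1`. -/
def ExpValid (tl hd : A → V) (o d : V) (K : ℕ) (e : A × ℕ × ℕ) : Prop :=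
  (tl e.1 = o ∧ hd e.1 ≠ d ∧ e.2.1 = 1 ∧ e.2.2 = 2) ∨
  (tl e.1 = o ∧ hd e.1 = d ∧ e.2.1 = 1 ∧ e.2.2 = K + 1) ∨
  (tl e.1 ≠ o ∧ tl e.1 ≠ d ∧ hd e.1 ≠ o ∧ hd e.1 ≠ d ∧
    2 ≤ e.2.1 ∧ e.2.1 + 1 ≤ K ∧ e.2.2 = e.2.1 + 1) ∨
  (hd e.1 = d ∧ tl e.1 ≠ o ∧ 2 ≤ e.2.1 ∧ e.2.1 ≤ K ∧ e.2.2 = K + 1)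

/-- In the walk `L` (with visited vertices `tl a₁, …, tl aₘ, hd aₘ`), the vertex `o`
occurs only as the first visited vertex and `d` only as the last visited vertex. -/
def OnlyEnds (tl hd : A → V) (o d : V) (L : List A) : Prop :=
  (∀ a ∈ L.tail, tl a ≠ o) ∧ (∀ a ∈ L, hd a ≠ o) ∧
  (∀ a ∈ L, tl a ≠ d) ∧ (∀ a ∈ L.dropLast, hd a ≠ d)

theorem isWalk_iff {tl hd : A → V} {u v : V} {L : List A} :
    IsWalk tl hd u v L ↔ L ≠ [] ∧ (∀ a ∈ L.head?, tl a = u) ∧ (∀ a ∈ L.getLast?, hd a = v) ∧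
      L.IsChain (fun a b => hd a = tl b) :=
  Iff.rfl

theorem isWalk_singleton {tl hd : A → V} {u v : V} {a : A} :
    IsWalk tl hd u v [a] ↔ tl a = u ∧ hd a = v := by
  simp [isWalk_iff]

theorem isWalk_cons_cons {tl hd : A → V} {u v : V} {a b : A} {l : List A} :
    IsWalk tl hd u v (a :: b :: l) ↔ tl a = u ∧ IsWalk tl hd (hd a) v (b :: l) := by
  simp only [isWalk_iff, List.isChain_cons_cons, List.head?_cons, List.getLast?_cons_cons,
    Option.mem_def, Option.some.injEq, forall_eq', ne_eq, reduceCtorEq, not_false_eq_true,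
    true_and]
  grind

theorem onlyEnds_singleton {tl hd : A → V} {o d : V} {a : A} :
    OnlyEnds tl hd o d [a] ↔ hd a ≠ o ∧ tl a ≠ d := by
  simp [OnlyEnds]

theorem onlyEnds_cons_cons {tl hd : A → V} {o d : V} {a b : A} {l : List A} :
    OnlyEnds tl hd o d (a :: b :: l) ↔
      tl b ≠ o ∧ hd a ≠ o ∧ tl a ≠ d ∧ hd a ≠ d ∧ OnlyEnds tl hd o d (b :: l) := by
  simp only [OnlyEnds, List.tail_cons, List.dropLast_cons_cons, List.forall_mem_cons]
  tauto

theorem ExpValid.hd_ne_origin {tl hd : A → V} (hsimple : ∀ a, tl a ≠ hd a) {o d : V}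
    (hod : o ≠ d) {K : ℕ} {e : A × ℕ × ℕ} (he : ExpValid tl hd o d K e) : hd e.1 ≠ o := by
  have := hsimple e.1
  unfold ExpValid at he
  grind

theorem ExpValid.tl_ne_destination {tl hd : A → V} (hsimple : ∀ a, tl a ≠ hd a) {o d : V}
    (hod : o ≠ d) {K : ℕ} {e : A × ℕ × ℕ} (he : ExpValid tl hd o d K e) : tl e.1 ≠ d := by
  have := hsimple e.1
  unfold ExpValid at he
  grind

theorem ExpValid.layer_le {tl hd : A → V} {o d : V} {K : ℕ} (hK : 1 ≤ K) {e : A × ℕ × ℕ}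
    (he : ExpValid tl hd o d K e) : e.2.1 ≤ K := by
  unfold ExpValid at he
  grind

theorem ExpValid.next_layer {tl hd : A → V} {o d : V} {K : ℕ} {e : A × ℕ × ℕ}
    (he : ExpValid tl hd o d K e) (h : hd e.1 ≠ d) : e.2.2 = e.2.1 + 1 := by
  unfold ExpValid at he
  grind

/-- Forgetting the layers turns a walk of the expanded graph into an admissible walk of the
underlying graph, whose length is bounded by the number of remaining layers. -/
theorem IsWalk.project {tl hd : A → V} (hsimple : ∀ a, tl a ≠ hd a) {o d : V} (hod : o ≠ d)
    {K : ℕ} (hK : 1 ≤ K) (L : List (A × ℕ × ℕ)) :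
    ∀ (v : V) (k : ℕ), (∀ e ∈ L, ExpValid tl hd o d K e) →
      IsWalk (ExpTl tl) (ExpHd hd) (v, k) (d, K + 1) L →
      IsWalk tl hd v d (L.map Prod.fst) ∧ OnlyEnds tl hd o d (L.map Prod.fst) ∧
        k + L.length ≤ K + 1 := by
  induction L with
  | nil => intro v k _ hw; exact absurd rfl hw.1
  | cons e L ih =>
    intro v k hv hw
    have he := hv e (by simp)
    have ho := he.hd_ne_origin hsimple hod
    have hd' := he.tl_ne_destination hsimple hod
    cases L with
    | nil =>
      have hk := he.layer_le hK
      simp only [isWalk_singleton, ExpTl, ExpHd, Prod.mk.injEq] at hw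
      simp only [List.map_cons, List.map_nil, isWalk_singleton, onlyEnds_singleton,
        List.length_singleton]
      grind
    | cons f L =>
      rw [isWalk_cons_cons] at hw
      obtain ⟨h1, h2, h3⟩ := ih _ _ (fun x hx => hv x (List.mem_cons_of_mem _ hx)) hw.2
      have hf := (hv f (by simp)).tl_ne_destination hsimple hod
      have hfe : tl f.1 = hd e.1 := h1.2.1 f.1 (by simp)
      have hn := he.next_layer (hfe ▸ hf)
      simp only [ExpTl, Prod.mk.injEq] at hw
      simp only [List.map_cons, List.length_cons] at h1 h2 h3 ⊢
      rw [isWalk_cons_cons, onlyEnds_cons_cons]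
      grind

/-- An admissible walk of the underlying graph lifts to the expanded graph, starting from any
layer that leaves enough room for its length. -/
theorem IsWalk.exists_lift {tl hd : A → V} {o d : V} {K : ℕ} (P : List A) :
    ∀ (v : V) (k : ℕ), IsWalk tl hd v d P → OnlyEnds tl hd o d P → k + P.length ≤ K + 1 →
      (v = o ∧ k = 1 ∨ v ≠ o ∧ 2 ≤ k) →
      ∃ L : List (A × ℕ × ℕ), (∀ e ∈ L, ExpValid tl hd o d K e) ∧
        IsWalk (ExpTl tl) (ExpHd hd) (v, k) (d, K + 1) L ∧ L.map Prod.fst = P := by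
  induction P with
  | nil => intro v k hw; exact absurd rfl hw.1
  | cons a P ih =>
    intro v k hw hE hlen hvk
    cases P with
    | nil =>
      rw [isWalk_singleton] at hw
      rw [onlyEnds_singleton] at hE
      rw [List.length_singleton] at hlen
      refine ⟨[(a, k, K + 1)], ?_, ?_, rfl⟩
      · simp only [List.mem_singleton, forall_eq, ExpValid]
        grind
      · simp [isWalk_singleton, ExpTl, ExpHd, hw]
    | cons b P =>
      rw [isWalk_cons_cons] at hw
      rw [onlyEnds_cons_cons] at hE
      simp only [List.length_cons] at hlen ih
      obtain ⟨L, hv, hL, hmap⟩ := ih (hd a) (k + 1) hw.2 hE.2.2.2.2 (by omega)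
        (Or.inr ⟨hE.2.1, by omega⟩)
      refine ⟨(a, k, k + 1) :: L, ?_, ?_, by simp [hmap]⟩
      · rw [List.forall_mem_cons]
        refine ⟨?_, hv⟩
        simp only [ExpValid]
        grind
      · cases L with
        | nil => exact absurd rfl hL.1
        | cons f L => exact isWalk_cons_cons.2 ⟨by simp [ExpTl, hw.1], hL⟩

/-- The set of costs of walks in `G` from `o` to `d` with at most `K`
arcs in which `o` and `d` occur only as first and last vertex equals the set of
costs of walks in `Ḡ` from `(o,1)` to `(d,K+1)`; consequently the two infima of
cost coincide: CSP on `G` is equivalent to SP on `Ḡ`. -/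
theorem csp_equiv_sp_on_expanded
    [Fintype V] [Fintype A]
    (tl hd : A → V) (γ : A → ℝ) (hsimple : ∀ a : A, tl a ≠ hd a)
    (K : ℕ) (hK : 2 ≤ K) (o d : V) (hod : o ≠ d) :
    {c : ℝ | ∃ P : List A, IsWalk tl hd o d P ∧ P.length ≤ K ∧
        OnlyEnds tl hd o d P ∧ (P.map γ).sum = c} =
      {c : ℝ | ∃ L : List (A × ℕ × ℕ), (∀ e ∈ L, ExpValid tl hd o d K e) ∧
        IsWalk (ExpTl tl) (ExpHd hd) (o, 1) (d, K + 1) L ∧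
        (L.map (fun e => γ e.1)).sum = c} ∧
    sInf {c : ℝ | ∃ P : List A, IsWalk tl hd o d P ∧ P.length ≤ K ∧
        OnlyEnds tl hd o d P ∧ (P.map γ).sum = c} =
      sInf {c : ℝ | ∃ L : List (A × ℕ × ℕ), (∀ e ∈ L, ExpValid tl hd o d K e) ∧
        IsWalk (ExpTl tl) (ExpHd hd) (o, 1) (d, K + 1) L ∧
        (L.map (fun e => γ e.1)).sum = c} := by
  rw [and_iff_left_of_imp (congrArg sInf)]
  ext c
  constructor
  · rintro ⟨P, hw, hlen, hE, rfl⟩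
    obtain ⟨L, hv, hL, rfl⟩ := IsWalk.exists_lift (K := K) P o 1 hw hE (by omega) (Or.inl ⟨rfl, rfl⟩)
    exact ⟨L, hv, hL, by simp [Function.comp_def]⟩
  · rintro ⟨L, hv, hL, rfl⟩
    obtain ⟨hw, hE, hlen⟩ := IsWalk.project hsimple hod (by omega) L o 1 hv hL
    exact ⟨L.map Prod.fst, hw, by simpa using by omega, hE, by simp [Function.comp_def]⟩

end Stmt2
end

section
/- Let S ⊆ A be a distinguished set of arcs of G (the shuttle arcs). Assume: (i) every arc a with tl a = o belongs to S; (ii) there is an arc a* ∈ S with tl a* = o and hd a* = d; and (iii) the triangle inequality holds for shuttle arcs through intermediate vertices: for all a₁ ∈ S with tl a₁ = o and a₂ ∈ S with tl a₂ = hd a₁ and hd a₂ = d, one has γ a₁ + γ a₂ ≥ γ a*. Then the infimum of the cost over walks in the transfer-expanded graph Ḡ from (o,1) to (d,K+1) is equal to the infimum of the cost over such walks that use no arc of Ḡ from a layer-2 vertex (i,2) to (d,K+1) whose underlying arc belongs to S; i.e., the shuttle arcs from layer 2 into the destination may be removed from Ḡ without changing the optimal value. -/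
namespace Stmt6

variable {V A : Type}

/-- `L` is a walk from `u` to `v` in the graph with tails `tl` and heads `hd`. -/
def IsWalk (tl hd : A → V) (u v : V) (L : List A) : Prop :=
  L ≠ [] ∧ (∀ a ∈ L.head?, tl a = u) ∧ (∀ a ∈ L.getLast?, hd a = v) ∧
    List.Chain' (fun a b => hd a = tl b) L

/-- Tail of an arc `(a, k, l)` of the transfer-expanded graph: vertex `(tl a, k)`. -/
def ExpTl (tl : A → V) (e : A × ℕ × ℕ) : V × ℕ := (tl e.1, e.2.1)

/-- Head of an arc `(a, k, l)` of the transfer-expanded graph: vertex `(hd a, l)`. -/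
def ExpHd (hd : A → V) (e : A × ℕ × ℕ) : V × ℕ := (hd e.1, e.2.2)

/-- `(a, k, l)` is an arc of the transfer-expanded graph `Ḡ` for origin `o`,
destination `d` and transfer budget `K`:
(1) arcs out of the origin go from layer 1 to layer 2 (or to layer `K+1` if they
    enter the destination directly);
(2) arcs not adjacent to the origin or the destination go from layer `k` to `k+1`
    for `2 ≤ k ≤ K-1`;
(3) arcs into the destination (not out of the origin) go from layer `k`,
    `2 ≤ k ≤ K`, to layer `K+1`. -/
def ExpValid (tl hd : A → V) (o d : V) (K : ℕ) (e : A × ℕ × ℕ) : Prop :=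
  (tl e.1 = o ∧ hd e.1 ≠ d ∧ e.2.1 = 1 ∧ e.2.2 = 2) ∨
  (tl e.1 = o ∧ hd e.1 = d ∧ e.2.1 = 1 ∧ e.2.2 = K + 1) ∨
  (tl e.1 ≠ o ∧ tl e.1 ≠ d ∧ hd e.1 ≠ o ∧ hd e.1 ≠ d ∧
    2 ≤ e.2.1 ∧ e.2.1 + 1 ≤ K ∧ e.2.2 = e.2.1 + 1) ∨
  (hd e.1 = d ∧ tl e.1 ≠ o ∧ 2 ≤ e.2.1 ∧ e.2.1 ≤ K ∧ e.2.2 = K + 1)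

/-- In the walk `L` (with visited vertices `tl a₁, …, tl aₘ, hd aₘ`), the vertex `o`
occurs only as the first visited vertex and `d` only as the last visited vertex. -/
def OnlyEnds (tl hd : A → V) (o d : V) (L : List A) : Prop :=
  (∀ a ∈ L.tail, tl a ≠ o) ∧ (∀ a ∈ L, hd a ≠ o) ∧
  (∀ a ∈ L, tl a ≠ d) ∧ (∀ a ∈ L.dropLast, hd a ≠ d)

/-- Two sets of reals, one inside the other and cofinal in it downwards, have the same `sInf`,
even when they are unbounded below. -/
theorem sInf_eq_of_subset_of_forall_exists_le {R T : Set ℝ} (hTR : T ⊆ R)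
    (h : ∀ x ∈ R, ∃ y ∈ T, y ≤ x) : sInf R = sInf T := by
  rcases R.eq_empty_or_nonempty with rfl | hR
  · rw [Set.subset_empty_iff.mp hTR]
  obtain ⟨x, hx⟩ := hR
  obtain ⟨y, hy, -⟩ := h x hx
  by_cases hb : BddBelow R
  · refine le_antisymm (csInf_le_csInf hb ⟨y, hy⟩ hTR) (le_csInf ⟨x, hx⟩ fun z hz => ?_)
    obtain ⟨w, hw, hwz⟩ := h z hz
    exact (csInf_le (hb.mono hTR) hw).trans hwz
  · have hb' : ¬ BddBelow T := by
      rintro ⟨m, hm⟩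
      refine hb ⟨m, fun z hz => ?_⟩
      obtain ⟨w, hw, hwz⟩ := h z hz
      exact (hm hw).trans hwz
    rw [Real.sInf_of_not_bddBelow hb, Real.sInf_of_not_bddBelow hb']

theorem ExpValid.layer_lt {tl hd : A → V} {o d : V} {K : ℕ} (hK : 2 ≤ K) {e : A × ℕ × ℕ}
    (he : ExpValid tl hd o d K e) : e.2.1 < e.2.2 := by
  unfold ExpValid at he
  omega

theorem ExpValid.layer_le {tl hd : A → V} {o d : V} {K : ℕ} (hK : 2 ≤ K) {e : A × ℕ × ℕ}
    (he : ExpValid tl hd o d K e) : e.2.1 ≤ K := by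
  unfold ExpValid at he
  omega

/-- Along a walk in the transfer-expanded graph the layers strictly increase. -/
theorem pairwise_layer_lt {tl hd : A → V} {o d : V} {K : ℕ} (hK : 2 ≤ K)
    {L : List (A × ℕ × ℕ)} (hL : ∀ e ∈ L, ExpValid tl hd o d K e)
    (hc : List.IsChain (fun a b => ExpHd hd a = ExpTl tl b) L) :
    L.Pairwise (fun a b => a.2.1 < b.2.1) := by
  have : IsTrans (A × ℕ × ℕ) (fun a b => a.2.1 < b.2.1) := ⟨fun _ _ _ => lt_trans⟩
  rw [← List.isChain_iff_pairwise]
  induction L with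
  | nil => exact .nil
  | cons a L ih =>
    rw [List.isChain_cons] at hc ⊢
    refine ⟨fun b hb => ?_, ih (fun e he => hL e (List.mem_cons_of_mem _ he)) hc.2⟩
    have h₁ : a.2.2 = b.2.1 := congrArg Prod.snd (hc.1 b hb)
    exact h₁ ▸ (hL a List.mem_cons_self).layer_lt hK

/-- A walk from the origin which uses an arc from layer 2 into the destination consists of
exactly two arcs. -/
theorem IsWalk.eq_pair_of_mem {tl hd : A → V} {o d : V} {K : ℕ} (hK : 2 ≤ K) {v : V × ℕ}
    {L : List (A × ℕ × ℕ)} (hL : ∀ e ∈ L, ExpValid tl hd o d K e)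
    (hw : IsWalk (ExpTl tl) (ExpHd hd) (o, 1) v L)
    {e : A × ℕ × ℕ} (he : e ∈ L) (he₂ : e.2.1 = 2) (heK : e.2.2 = K + 1) :
    ∃ e₁, L = [e₁, e] ∧ tl e₁.1 = o ∧ hd e₁.1 = tl e.1 := by
  obtain ⟨-, hh, -, hc⟩ := hw
  have hp := pairwise_layer_lt hK hL hc
  match L with
  | [] => simp at he
  | [a] =>
    have h₁ : a.2.1 = 1 := congrArg Prod.snd (hh a rfl)
    obtain rfl := List.mem_singleton.mp he
    omega
  | a :: b :: M =>
    have ho : tl a.1 = o := congrArg Prod.fst (hh a rfl)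
    have h₁ : a.2.1 = 1 := congrArg Prod.snd (hh a rfl)
    replace hc := List.isChain_cons_cons.mp hc
    have hab : hd a.1 = tl b.1 := congrArg Prod.fst hc.1
    rw [List.pairwise_cons, List.pairwise_cons] at hp
    have hlt := hp.1 b List.mem_cons_self
    rcases List.mem_cons.mp he with rfl | he
    · omega
    rcases List.mem_cons.mp he with rfl | he
    · match M with
      | [] => exact ⟨a, rfl, ho, hab⟩
      | c :: M =>
        have hec : e.2.2 = c.2.1 := congrArg Prod.snd (List.isChain_cons_cons.mp hc.2).1
        have hcK := (hL c (by simp)).layer_le hK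
        omega
    · have := hp.2.1 e he
      omega

/-- Let `S` be the set of shuttle arcs. If (i) every arc out of `o` is
a shuttle arc, (ii) there is a direct shuttle arc `a✶ ∈ S` from `o` to `d`, and
(iii) the triangle inequality `γ a✶ ≤ γ a₁ + γ a₂` holds for shuttle paths
`o → hd a₁ → d`, then the infimum of cost over walks in `Ḡ` from `(o,1)` to
`(d,K+1)` equals the infimum over such walks that use no arc of `Ḡ` from a layer-2
vertex to `(d,K+1)` whose underlying arc is a shuttle arc: those arcs can be
removed from `Ḡ` without changing the optimal value. -/
theorem shuttle_arcs_removable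
    [Fintype V] [Fintype A]
    (tl hd : A → V) (γ : A → ℝ) (hsimple : ∀ a : A, tl a ≠ hd a)
    (K : ℕ) (hK : 2 ≤ K) (o d : V) (hod : o ≠ d)
    (S : Set A)
    (hout : ∀ a : A, tl a = o → a ∈ S)
    (astar : A) (hstar : astar ∈ S ∧ tl astar = o ∧ hd astar = d)
    (htri : ∀ a₁ ∈ S, ∀ a₂ ∈ S, tl a₁ = o → tl a₂ = hd a₁ → hd a₂ = d →
      γ astar ≤ γ a₁ + γ a₂) :
    sInf {c : ℝ | ∃ L : List (A × ℕ × ℕ), (∀ e ∈ L, ExpValid tl hd o d K e) ∧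
        IsWalk (ExpTl tl) (ExpHd hd) (o, 1) (d, K + 1) L ∧
        (L.map (fun e => γ e.1)).sum = c} =
      sInf {c : ℝ | ∃ L : List (A × ℕ × ℕ), (∀ e ∈ L, ExpValid tl hd o d K e) ∧
        IsWalk (ExpTl tl) (ExpHd hd) (o, 1) (d, K + 1) L ∧
        (∀ e ∈ L, ¬(e.1 ∈ S ∧ e.2.1 = 2 ∧ hd e.1 = d ∧ e.2.2 = K + 1)) ∧
        (L.map (fun e => γ e.1)).sum = c} := by
  refine sInf_eq_of_subset_of_forall_exists_le ?_ ?_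
  · rintro c ⟨L, hL, hw, -, hc⟩
    exact ⟨L, hL, hw, hc⟩
  · rintro c ⟨L, hL, hw, rfl⟩
    by_cases hbad : ∃ e ∈ L, e.1 ∈ S ∧ e.2.1 = 2 ∧ hd e.1 = d ∧ e.2.2 = K + 1
    · obtain ⟨e, he, heS, he₂, hed, heK⟩ := hbad
      obtain ⟨e₁, rfl, ho, hm⟩ := hw.eq_pair_of_mem hK hL he he₂ heK
      obtain ⟨-, hso, hsd⟩ := hstar
      refine ⟨γ astar, ⟨[(astar, 1, K + 1)], ?_, ?_, ?_, ?_⟩, ?_⟩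
      · simp [ExpValid, hso, hsd]
      · exact ⟨by simp, by simp [ExpTl, hso], by simp [ExpHd, hsd], .singleton _⟩
      · simp
      · simp
      · simpa using htri e₁.1 (hout _ ho) e.1 heS ho hm.symm hed
    · exact ⟨_, ⟨L, hL, hw, fun e he h => hbad ⟨e, he, h⟩, rfl⟩, le_rfl⟩

end Stmt6
end

section
/- Let n, m be natural numbers, c ∈ ℝⁿ, C ⊆ ℝⁿ a set, and B : ℝⁿ → ℝᵐ a linear map. For z ∈ ℝᵐ define Φ(z) = inf { ⟨c, y⟩ : y ∈ C and B y ≤ z componentwise }. Let z̄ ∈ ℝᵐ and λ ∈ ℝᵐ with λ ≥ 0 componentwise be such that strong Lagrangian duality holds at z̄: Φ(z̄) = inf { ⟨c, y⟩ + ⟨λ, B y − z̄⟩ : y ∈ C }. Then for every z ∈ ℝᵐ whose feasible set { y ∈ C : B y ≤ z } is nonempty, Φ(z) ≥ Φ(z̄) − ⟨λ, z − z̄⟩; i.e., the Benders optimality cut generated from the dual multipliers at z̄ is valid for the value function at every other design z. -/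
namespace Stmt8

/-- Let `Φ z = inf { ⟨c, y⟩ : y ∈ C, B y ≤ z componentwise }`.
Suppose `λ ≥ 0` and strong Lagrangian duality holds at `z̄`, i.e. `Φ z̄` is the
infimum of the Lagrangian `⟨c, y⟩ + ⟨λ, B y - z̄⟩` over `y ∈ C` (stated as a
greatest lower bound). Then for every `z` whose feasible set is nonempty (and on
which the objective is bounded below, so that the infimum defining `Φ z` is a real
number), the Benders optimality cut is valid:
`Φ z ≥ Φ z̄ - ⟨λ, z - z̄⟩`. -/
theorem benders_cut_valid
    (n m : ℕ) (c : Fin n → ℝ) (C : Set (Fin n → ℝ))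
    (B : (Fin n → ℝ) →ₗ[ℝ] (Fin m → ℝ))
    (Φ : (Fin m → ℝ) → ℝ)
    (hΦ : ∀ z : Fin m → ℝ,
      Φ z = sInf {x : ℝ | ∃ y ∈ C, (∀ j, B y j ≤ z j) ∧ ∑ i, c i * y i = x})
    (zbar lam : Fin m → ℝ) (hlam : ∀ j, 0 ≤ lam j)
    (hstrong : IsGLB
      {x : ℝ | ∃ y ∈ C, (∑ i, c i * y i) + (∑ j, lam j * (B y j - zbar j)) = x}
      (Φ zbar))
    (z : Fin m → ℝ)
    (hfeas : ∃ y ∈ C, ∀ j, B y j ≤ z j)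
    (hbdd : BddBelow {x : ℝ | ∃ y ∈ C, (∀ j, B y j ≤ z j) ∧ ∑ i, c i * y i = x}) :
    Φ zbar - ∑ j, lam j * (z j - zbar j) ≤ Φ z := by
  rw [hΦ z]
  obtain ⟨y₀, hy₀, hy₀z⟩ := hfeas
  refine le_csInf ⟨_, y₀, hy₀, hy₀z, rfl⟩ ?_
  rintro _ ⟨y, hy, hyz, rfl⟩
  have hLagrangian := hstrong.1 ⟨y, hy, rfl⟩
  have hpenalty : ∑ j, lam j * (B y j - zbar j) ≤ ∑ j, lam j * (z j - zbar j) :=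
    Finset.sum_le_sum fun j _ =>
      mul_le_mul_of_nonneg_left (sub_le_sub_right (hyz j) _) (hlam j)
  linarith

end Stmt8
end
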